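/- A U(g_E)-module M belongs to category O^∞_alg if and only if there is a finite filtration 0 = M_0 ⊆ M_1 ⊆ … ⊆ M_n = M by U(g_E)-submodules such that every quotient M_k/M_{k−1}, 1 ≤ k ≤ n, lies in category O_alg. -/

import Mathlib

noncomputable section

namespace PaperO

variable (E : Type) [Field E]
variable (g : Type) [LieRing g] [LieAlgebra E g]
variable (t b : LieSubalgebra E g)

section WeightTheory

variable (M : Type) [AddCommGroup M] [Module E M] [LieRingModule g M] [LieModule E g M]

/-- `M^i_χ`: the subspace of all `m` with `(h - χ(h))^i • m = 0` for all `h ∈ t`. -/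
def wsp (i : ℕ) (χ : Module.Dual E ↥t) : Submodule E M :=
  ⨅ h : ↥t, LinearMap.ker ((LieModule.toEnd E g M (h : g) - χ h • (1 : Module.End E M)) ^ i)

/-- The generalized weight space `M^∞_χ = ⋃ i, M^i_χ`. -/
def gwsp (χ : Module.Dual E ↥t) : Submodule E M := ⨆ i : ℕ, wsp E g t M i χ

/-- The set of weights `Π(M)` of `M`. -/
def weights : Set (Module.Dual E ↥t) := {χ | gwsp E g t M χ ≠ ⊥}

/-- `M` is `E`-split: it is the direct sum of its generalized weight spaces. -/
def IsESplit : Prop :=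
  letI : DecidableEq (Module.Dual E ↥t) := Classical.decEq _
  DirectSum.IsInternal (fun χ : Module.Dual E ↥t => gwsp E g t M χ)

/-- `M` is diagonalizable: it is the direct sum of its weight spaces. -/
def IsDiagonalizable : Prop :=
  letI : DecidableEq (Module.Dual E ↥t) := Classical.decEq _
  DirectSum.IsInternal (fun χ : Module.Dual E ↥t => wsp E g t M 1 χ)

/-- The action of `b` on `M` is locally finite: every `m ∈ M` lies in a
finite-dimensional `b`-stable subspace (equivalently, `U(b)·m` is finite-dimensional). -/
def IsLocBFinite : Prop :=
  ∀ m : M, ∃ W : Submodule E M, FiniteDimensional E ↥W ∧ m ∈ W ∧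
    ∀ x : ↥b, ∀ w ∈ W, ⁅(x : g), w⁆ ∈ W

/-- `M` is finitely generated as a `U(g)`-module (equivalently, as a Lie module). -/
def IsFG : Prop := ∃ S : Finset M, LieSubmodule.lieSpan E g (S : Set M) = ⊤

/-- Membership in the BGG category `O` for `(g, b, t)`. -/
def InCatO : Prop := IsFG E g M ∧ IsDiagonalizable E g t M ∧ IsLocBFinite E g b M

/-- Membership in the thick category `O^∞` for `(g, b, t)`. -/
def InCatOInf : Prop := IsFG E g M ∧ IsESplit E g t M ∧ IsLocBFinite E g b M

variable (Λ : AddSubgroup (Module.Dual E ↥t))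

/-- All weights of `M` are algebraic, i.e. lie in the subgroup `Λ ⊆ t*` which is
the image of the derivative map `d : X*(T) → t*`. -/
def IsAlgWt : Prop := ∀ χ ∈ weights E g t M, χ ∈ Λ

/-- Membership in the category `O_alg`. -/
def InCatOAlg : Prop := InCatO E g t b M ∧ IsAlgWt E g t M Λ

/-- Membership in the category `O^∞_alg`. -/
def InCatOInfAlg : Prop := InCatOInf E g t b M ∧ IsAlgWt E g t M Λ

end WeightTheory

/-- The root space `g_α` for a linear form `α` on `t`. -/
def rootSp (α : Module.Dual E ↥t) : Submodule E g :=
  ⨅ h : ↥t, LinearMap.ker (((LieAlgebra.ad E g) (h : g) - α h • (1 : Module.End E g)))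

/-- The subquotient `c (k+1) / c k` of a filtration by Lie submodules. -/
abbrev filtQuot {E : Type} [Field E] {g : Type} [LieRing g] [LieAlgebra E g]
    {M : Type} [AddCommGroup M] [Module E M] [LieRingModule g M] [LieModule E g M]
    (c : ℕ → LieSubmodule E g M) (k : ℕ) :=
  (↥(c (k + 1))) ⧸ (LieSubmodule.comap (c (k + 1)).incl (c k))

set_option linter.unusedSectionVars false

section Weights

variable {E : Type} [Field E] {g : Type} [LieRing g] [LieAlgebra E g] {t b : LieSubalgebra E g}
variable {M : Type} [AddCommGroup M] [Module E M] [LieRingModule g M] [LieModule E g M]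
variable {P : Type} [AddCommGroup P] [Module E P] [LieRingModule g P] [LieModule E g P]

lemma mem_wsp {i : ℕ} {χ : Module.Dual E ↥t} {m : M} :
    m ∈ wsp E g t M i χ ↔
      ∀ h : ↥t, ((LieModule.toEnd E g M (h : g) - χ h • (1 : Module.End E M)) ^ i) m = 0 := by
  simp [wsp]

lemma mem_wsp_one {χ : Module.Dual E ↥t} {m : M} :
    m ∈ wsp E g t M 1 χ ↔ ∀ h : ↥t, ⁅(h : g), m⁆ - χ h • m = 0 := by
  simp [mem_wsp]

lemma wsp_mono (χ : Module.Dual E ↥t) : Monotone fun i => wsp E g t M i χ := by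
  intro i j hij m hm
  rw [mem_wsp] at hm ⊢
  intro h
  rw [← Nat.sub_add_cancel hij, pow_add, Module.End.mul_apply, hm h, map_zero]

lemma mem_gwsp {χ : Module.Dual E ↥t} {m : M} :
    m ∈ gwsp E g t M χ ↔ ∃ i, m ∈ wsp E g t M i χ :=
  Submodule.mem_iSup_of_directed _ (wsp_mono χ).directed_le

lemma wsp_le_gwsp (i : ℕ) (χ : Module.Dual E ↥t) : wsp E g t M i χ ≤ gwsp E g t M χ :=
  le_iSup (fun i => wsp E g t M i χ) i

lemma map_pow_toEnd_sub (f : M →ₗ⁅E,g⁆ P) (x : g) (a : E) (i : ℕ) (m : M) :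
    f (((LieModule.toEnd E g M x - a • (1 : Module.End E M)) ^ i) m) =
      ((LieModule.toEnd E g P x - a • (1 : Module.End E P)) ^ i) (f m) := by
  induction i with
  | zero => simp
  | succ i ih => simp [pow_succ', ih]

lemma map_mem_wsp (f : M →ₗ⁅E,g⁆ P) {i : ℕ} {χ : Module.Dual E ↥t} {m : M}
    (hm : m ∈ wsp E g t M i χ) : f m ∈ wsp E g t P i χ := by
  rw [mem_wsp] at hm ⊢
  intro h
  rw [← map_pow_toEnd_sub, hm h, map_zero]

lemma map_mem_gwsp (f : M →ₗ⁅E,g⁆ P) {χ : Module.Dual E ↥t} {m : M}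
    (hm : m ∈ gwsp E g t M χ) : f m ∈ gwsp E g t P χ := by
  obtain ⟨i, hi⟩ := mem_gwsp.1 hm
  exact mem_gwsp.2 ⟨i, map_mem_wsp f hi⟩

lemma mem_gwsp_of_injective (f : M →ₗ⁅E,g⁆ P) (hf : Function.Injective f)
    {χ : Module.Dual E ↥t} {m : M} (hm : f m ∈ gwsp E g t P χ) : m ∈ gwsp E g t M χ := by
  obtain ⟨i, hi⟩ := mem_gwsp.1 hm
  refine mem_gwsp.2 ⟨i, ?_⟩
  rw [mem_wsp] at hi ⊢
  intro h
  apply hf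
  rw [map_pow_toEnd_sub, hi h, map_zero]

/-- Root vectors shift generalized weight spaces. -/
lemma lie_mem_gwsp {α χ : Module.Dual E ↥t} {x : g} (hx : x ∈ rootSp E g t α) {m : M}
    (hm : m ∈ gwsp E g t M χ) : ⁅x, m⁆ ∈ gwsp E g t M (α + χ) := by
  obtain ⟨i, hi⟩ := mem_gwsp.1 hm
  refine mem_gwsp.2 ⟨i, mem_wsp.2 fun h => ?_⟩
  have hx' : ⁅(h : g), x⁆ = α h • x := by
    simpa [rootSp, sub_eq_zero] using (Submodule.mem_iInf _).1 hx h
  have key : ∀ (j : ℕ) (m : M),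
      ((LieModule.toEnd E g M (h : g) - (α + χ) h • (1 : Module.End E M)) ^ j) ⁅x, m⁆ =
        ⁅x, ((LieModule.toEnd E g M (h : g) - χ h • (1 : Module.End E M)) ^ j) m⁆ := by
    intro j
    induction j with
    | zero => simp
    | succ j ih =>
      intro m
      rw [pow_succ, pow_succ, Module.End.mul_apply, Module.End.mul_apply, ← ih]
      congr 1
      simp only [LinearMap.sub_apply, LieModule.toEnd_apply_apply, LinearMap.smul_apply,
        Module.End.one_apply, lie_sub, lie_smul, LinearMap.add_apply]
      rw [leibniz_lie, hx', smul_lie, add_smul]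
      abel
  rw [key, mem_wsp.1 hi h, lie_zero]

lemma iSupIndep_gwsp [IsLieAbelian ↥t] : iSupIndep fun χ : Module.Dual E ↥t => gwsp E g t M χ := by
  have h := (Module.End.independent_iInf_maxGenEigenspace_of_forall_mapsTo
    (fun h : ↥t => LieModule.toEnd E g M (h : g)) (fun i j φ =>
      Module.End.mapsTo_maxGenEigenspace_of_comm (by
        have hij : ⁅(j : g), (i : g)⁆ = 0 := by
          rw [← LieSubalgebra.coe_bracket, trivial_lie_zero, ZeroMemClass.coe_zero]
        ext m
        have := leibniz_lie (j : g) (i : g) m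
        rw [hij, zero_lie, zero_add] at this
        simpa using this) φ)).comp
    (f := fun (χ : Module.Dual E ↥t) => (χ : ↥t → E)) DFunLike.coe_injective
  refine h.mono fun χ => ?_
  intro m hm
  obtain ⟨i, hi⟩ := mem_gwsp.1 hm
  simp only [Function.comp_apply, Submodule.mem_iInf, Module.End.mem_maxGenEigenspace]
  exact fun h => ⟨i, mem_wsp.1 hi h⟩

lemma isESplit_iff [IsLieAbelian ↥t] :
    IsESplit E g t M ↔ ⨆ χ : Module.Dual E ↥t, gwsp E g t M χ = ⊤ := by
  classical
  rw [IsESplit, DirectSum.isInternal_submodule_iff_iSupIndep_and_iSup_eq_top]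
  exact and_iff_right iSupIndep_gwsp

lemma isDiagonalizable_iff [IsLieAbelian ↥t] :
    IsDiagonalizable E g t M ↔ ⨆ χ : Module.Dual E ↥t, wsp E g t M 1 χ = ⊤ := by
  classical
  rw [IsDiagonalizable, DirectSum.isInternal_submodule_iff_iSupIndep_and_iSup_eq_top]
  exact and_iff_right (iSupIndep_gwsp.mono fun χ => wsp_le_gwsp 1 χ)

/-- If the generalized weight spaces for weights in `Λ` span `M`, every weight lies in `Λ`. -/
lemma isAlgWt_of_iSup_eq_top [IsLieAbelian ↥t] {Λ : AddSubgroup (Module.Dual E ↥t)}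
    (h : ⨆ χ ∈ Λ, gwsp E g t M χ = ⊤) : IsAlgWt E g t M Λ := by
  intro χ hχ
  by_contra hΛ
  apply hχ
  have hd := iSupIndep_gwsp (E := E) (g := g) (t := t) (M := M) χ
  have hle : ⨆ ψ ∈ Λ, gwsp E g t M ψ ≤ ⨆ ψ, ⨆ (_ : ψ ≠ χ), gwsp E g t M ψ :=
    iSup₂_le fun ψ hψ => le_iSup₂_of_le ψ (fun e => hΛ (e ▸ hψ)) le_rfl
  rw [h, top_le_iff] at hle
  rw [hle] at hd
  exact disjoint_top.1 hd

lemma iSup_gwsp_le_of_isAlgWt {Λ : AddSubgroup (Module.Dual E ↥t)} (h : IsAlgWt E g t M Λ) :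
    ⨆ χ, gwsp E g t M χ ≤ ⨆ χ ∈ Λ, gwsp E g t M χ := by
  refine iSup_le fun χ => ?_
  by_cases hχ : gwsp E g t M χ = ⊥
  · rw [hχ]; exact bot_le
  · exact le_iSup₂_of_le χ (h χ hχ) le_rfl

end Weights

section Finiteness

variable {E : Type} [Field E] {g : Type} [LieRing g] [LieAlgebra E g] {b : LieSubalgebra E g}
variable {M : Type} [AddCommGroup M] [Module E M] [LieRingModule g M] [LieModule E g M]
variable {P : Type} [AddCommGroup P] [Module E P] [LieRingModule g P] [LieModule E g P]

lemma map_lieSpan (f : M →ₗ⁅E,g⁆ P) (s : Set M) :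
    (LieSubmodule.lieSpan E g s).map f = LieSubmodule.lieSpan E g (f '' s) := by
  apply le_antisymm
  · rw [LieSubmodule.map_le_iff_le_comap, LieSubmodule.lieSpan_le]
    exact fun x hx => LieSubmodule.subset_lieSpan ⟨x, hx, rfl⟩
  · rw [LieSubmodule.lieSpan_le]
    rintro _ ⟨x, hx, rfl⟩
    exact LieSubmodule.mem_map_of_mem (LieSubmodule.subset_lieSpan hx)

lemma isFG_of_surjective (f : M →ₗ⁅E,g⁆ P) (hf : Function.Surjective f) (h : IsFG E g M) :
    IsFG E g P := by
  classical
  obtain ⟨S, hS⟩ := h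
  refine ⟨S.image f, ?_⟩
  rw [Finset.coe_image, ← map_lieSpan, hS, eq_top_iff]
  intro x _
  obtain ⟨y, rfl⟩ := hf x
  exact LieSubmodule.mem_map_of_mem (LieSubmodule.mem_top _)

lemma isFG_coe_iff (N : LieSubmodule E g M) :
    IsFG E g ↥N ↔ ∃ S : Finset M, LieSubmodule.lieSpan E g (S : Set M) = N := by
  classical
  constructor
  · rintro ⟨S, hS⟩
    refine ⟨S.image N.incl, ?_⟩
    rw [Finset.coe_image, ← map_lieSpan, hS, LieSubmodule.map_incl_top]
  · rintro ⟨S, hS⟩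
    have hSN : ∀ x ∈ S, x ∈ N := fun x hx => hS ▸ LieSubmodule.subset_lieSpan hx
    refine ⟨S.attach.image fun x => ⟨x.1, hSN x.1 x.2⟩, ?_⟩
    apply LieSubmodule.map_injective_of_injective (f := N.incl) Subtype.val_injective
    rw [map_lieSpan, LieSubmodule.map_incl_top]
    convert hS using 2
    ext x
    constructor
    · rintro ⟨y, hy, rfl⟩
      obtain ⟨z, -, rfl⟩ := Finset.mem_image.1 (Finset.mem_coe.1 hy)
      exact z.2
    · intro hx
      exact ⟨⟨x, hSN x hx⟩, by simpa using hx, rfl⟩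

lemma isLocBFinite_of_surjective (f : M →ₗ⁅E,g⁆ P) (hf : Function.Surjective f)
    (h : IsLocBFinite E g b M) : IsLocBFinite E g b P := by
  intro p
  obtain ⟨m, rfl⟩ := hf p
  obtain ⟨W, hW, hm, hst⟩ := h m
  refine ⟨W.map (f : M →ₗ[E] P), inferInstance, ⟨m, hm, rfl⟩, ?_⟩
  rintro x _ ⟨w, hw, rfl⟩
  exact ⟨⁅(x : g), w⁆, hst x w hw, by simp⟩

lemma isLocBFinite_of_injective (f : M →ₗ⁅E,g⁆ P) (hf : Function.Injective f)
    (h : IsLocBFinite E g b P) : IsLocBFinite E g b M := by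
  intro m
  obtain ⟨W, hW, hm, hst⟩ := h (f m)
  refine ⟨W.comap (f : M →ₗ[E] P), ?_, hm, fun x w hw => ?_⟩
  · exact Module.Finite.of_injective
      ((f : M →ₗ[E] P).restrict (p := W.comap (f : M →ₗ[E] P)) (q := W) fun _ hx => hx)
      fun x y hxy => Subtype.ext (hf (congrArg Subtype.val hxy))
  · simpa using hst x _ hw

end Finiteness

section NilpotentPart

variable {E : Type} [Field E] {g : Type} [LieRing g] [LieAlgebra E g] {t b : LieSubalgebra E g}
variable {M : Type} [AddCommGroup M] [Module E M] [LieRingModule g M] [LieModule E g M]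

lemma inCatOAlg_quotient [IsLieAbelian ↥t] {Λ : AddSubgroup (Module.Dual E ↥t)}
    (P Q : LieSubmodule E g M) (hfg : IsFG E g ↥P) (hb : IsLocBFinite E g b M)
    (hP : P.toSubmodule ≤ ⨆ χ ∈ Λ, P.toSubmodule ⊓ gwsp E g t M χ)
    (hPQ : ∀ χ, ∀ m ∈ P, m ∈ gwsp E g t M χ → ∀ h : ↥t, ⁅(h : g), m⁆ - χ h • m ∈ Q) :
    InCatOAlg E g t b (↥P ⧸ LieSubmodule.comap P.incl Q) Λ := by
  set π := LieSubmodule.Quotient.mk' (LieSubmodule.comap P.incl Q)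
  have hπ : Function.Surjective π := LieSubmodule.Quotient.surjective_mk' _
  have hspan : ⨆ χ ∈ Λ, wsp E g t (↥P ⧸ LieSubmodule.comap P.incl Q) 1 χ = ⊤ := by
    rw [eq_top_iff]
    rintro q -
    obtain ⟨⟨m, hm⟩, rfl⟩ := hπ q
    have hle : ⨆ χ ∈ Λ, P.toSubmodule ⊓ gwsp E g t M χ ≤
        (Submodule.comap (π : ↥P →ₗ[E] _)
          (⨆ χ ∈ Λ, wsp E g t (↥P ⧸ LieSubmodule.comap P.incl Q) 1 χ)).map
            P.toSubmodule.subtype := by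
      refine iSup₂_le fun χ hχ x hx => ⟨⟨x, hx.1⟩, ?_, rfl⟩
      refine (le_iSup₂ (f := fun χ (_ : χ ∈ Λ) => wsp E g t _ 1 χ) χ hχ) (mem_wsp_one.2 fun h => ?_)
      have h0 : π (⁅(h : g), (⟨x, hx.1⟩ : ↥P)⁆ - χ h • (⟨x, hx.1⟩ : ↥P)) = 0 :=
        (LieSubmodule.Quotient.mk_eq_zero _).2 (hPQ χ x hx.1 hx.2 h)
      rw [map_sub, LieModuleHom.map_lie, map_smul] at h0
      exact h0
    obtain ⟨y, hy, hym⟩ := hle (hP hm)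
    have : y = ⟨m, hm⟩ := Subtype.ext hym
    exact this ▸ hy
  refine ⟨⟨isFG_of_surjective π hπ hfg, isDiagonalizable_iff.2 ?_, isLocBFinite_of_surjective π hπ
    (isLocBFinite_of_injective P.incl Subtype.val_injective hb)⟩, isAlgWt_of_iSup_eq_top ?_⟩
  · exact top_le_iff.1 (hspan ▸ iSup₂_le fun χ _ => le_iSup (fun χ => wsp E g t _ 1 χ) χ)
  · exact top_le_iff.1 (hspan ▸ iSup₂_mono fun χ _ => wsp_le_gwsp 1 χ)

lemma linearMap_ext_of_gwsp {P : Type} [AddCommGroup P] [Module E P]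
    (htop : ⨆ χ : Module.Dual E ↥t, gwsp E g t M χ = ⊤) {f f' : M →ₗ[E] P}
    (h : ∀ χ, ∀ m ∈ gwsp E g t M χ, f m = f' m) : f = f' := by
  have : (⊤ : Submodule E M) ≤ LinearMap.eqLocus f f' := htop ▸ iSup_le fun χ m hm => h χ m hm
  exact LinearMap.ext fun m => this Submodule.mem_top

lemma toSubmodule_le_rootSp_zero [IsLieAbelian ↥t] : t.toSubmodule ≤ rootSp E g t 0 := by
  intro x hx
  refine (Submodule.mem_iInf _).2 fun h => ?_
  have : ⁅(h : g), x⁆ = 0 := by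
    rw [← LieSubalgebra.coe_bracket t h ⟨x, hx⟩, trivial_lie_zero, ZeroMemClass.coe_zero]
  simp [this]

/-- On an `E`-split module the nilpotent parts of the elements of `t` are module
endomorphisms, depending linearly on the element. -/
lemma exists_nilpotentPart [IsLieAbelian ↥t] (hM : IsESplit E g t M)
    (hroot : ⨆ α : Module.Dual E ↥t, rootSp E g t α = ⊤) :
    ∃ ν : ↥t →ₗ[E] (M →ₗ⁅E,g⁆ M), ∀ (h : ↥t) (χ : Module.Dual E ↥t),
      ∀ m ∈ gwsp E g t M χ, ν h m = ⁅(h : g), m⁆ - χ h • m := by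
  let _ : DecidableEq (Module.Dual E ↥t) := Classical.decEq _
  have htop := isESplit_iff.1 hM
  have hs : ∀ h : ↥t, ∃ n : M →ₗ[E] M, ∀ χ, ∀ m ∈ gwsp E g t M χ, n m = ⁅(h : g), m⁆ - χ h • m := by
    intro h
    let e := LinearEquiv.ofBijective (DirectSum.coeLinearMap fun χ => gwsp E g t M χ) hM
    refine ⟨LieModule.toEnd E g M (h : g) -
      (DirectSum.toModule E _ M fun χ => χ h • (gwsp E g t M χ).subtype) ∘ₗ e.symm.toLinearMap,
      fun χ m hm => ?_⟩
    have he : e.symm m = DirectSum.lof E _ (fun χ => gwsp E g t M χ) χ ⟨m, hm⟩ := by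
      rw [LinearEquiv.symm_apply_eq]
      exact (DirectSum.coeLinearMap_lof (fun χ => gwsp E g t M χ) χ ⟨m, hm⟩).symm
    simp [he]
  choose n hn using hs
  have hlie : ∀ (h : ↥t) (x : g) (m : M), n h ⁅x, m⁆ = ⁅x, n h m⁆ := by
    intro h x m
    have hx : x ∈ ⨆ α : Module.Dual E ↥t, rootSp E g t α := hroot ▸ Submodule.mem_top
    induction hx using Submodule.iSup_induction' with
    | zero => simp
    | add x y _ _ hx hy => simp [hx, hy]
    | mem α x hx =>
      have : n h ∘ₗ LieModule.toEnd E g M x = LieModule.toEnd E g M x ∘ₗ n h := by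
        refine linearMap_ext_of_gwsp htop fun χ m hm => ?_
        have hx' : ⁅(h : g), x⁆ = α h • x := by
          simpa [rootSp, sub_eq_zero] using (Submodule.mem_iInf _).1 hx h
        simp only [LinearMap.comp_apply, LieModule.toEnd_apply_apply]
        rw [hn h _ _ (lie_mem_gwsp hx hm), hn h _ _ hm, leibniz_lie, hx', lie_sub, smul_lie,
          lie_smul, LinearMap.add_apply, add_smul]
        abel
      exact LinearMap.congr_fun this m
  refine ⟨{ toFun := fun h => { n h with map_lie' := fun {x m} => hlie h x m }
            map_add' := fun h h' => ?_
            map_smul' := fun a h => ?_ }, fun h χ m hm => hn h χ m hm⟩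
  · have : n (h + h') = n h + n h' := by
      refine linearMap_ext_of_gwsp htop fun χ m hm => ?_
      simp only [LinearMap.add_apply, hn _ _ _ hm, map_add, add_smul]
      rw [show ((h + h' : ↥t) : g) = (h : g) + (h' : g) from rfl, add_lie]
      abel
    ext m
    exact LinearMap.congr_fun this m
  · have : n (a • h) = a • n h := by
      refine linearMap_ext_of_gwsp htop fun χ m hm => ?_
      simp only [LinearMap.smul_apply, hn _ _ _ hm, map_smul, smul_sub, smul_smul, smul_eq_mul]
      simp
    ext m
    exact LinearMap.congr_fun this m

variable (ν : ↥t →ₗ[E] (M →ₗ⁅E,g⁆ M))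

lemma apply_eq_sum_repr {ι : Type} [Fintype ι] (e : Module.Basis ι E ↥t) (h : ↥t) (m : M) :
    ν h m = ∑ i, e.repr h i • ν (e i) m := by
  let φ : ↥t →ₗ[E] M :=
    { toFun := fun h => ν h m
      map_add' := fun h h' => by simp
      map_smul' := fun c h => by simp }
  change φ h = ∑ i, e.repr h i • φ (e i)
  conv_lhs => rw [← e.sum_repr h]
  simp only [map_sum, map_smul]

/-- The submodules spanned by the `k`-fold products of the endomorphisms `ν h`. -/
def powRange : ℕ → LieSubmodule E g M
  | 0 => ⊤
  | k + 1 => ⨆ h : ↥t, (powRange k).map (ν h)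

lemma map_mem_powRange_succ (h : ↥t) {k : ℕ} {m : M} (hm : m ∈ powRange ν k) :
    ν h m ∈ powRange ν (k + 1) :=
  (le_iSup (fun h : ↥t => (powRange ν k).map (ν h)) h) (LieSubmodule.mem_map_of_mem hm)

lemma powRange_antitone : Antitone (powRange ν) := by
  refine antitone_nat_of_succ_le fun k => ?_
  induction k with
  | zero => exact le_top
  | succ k ih => exact iSup_mono fun h => LieSubmodule.map_mono ih

lemma exists_lieSpan_eq_powRange [Module.Finite E ↥t] (hM : IsFG E g M) (k : ℕ) :
    ∃ S : Finset M, LieSubmodule.lieSpan E g (S : Set M) = powRange ν k := by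
  classical
  induction k with
  | zero => exact hM
  | succ k ih =>
    obtain ⟨S, hS⟩ := ih
    let e := Module.finBasis E ↥t
    refine ⟨Finset.univ.biUnion fun i => S.image (ν (e i)), le_antisymm ?_ ?_⟩
    · rw [LieSubmodule.lieSpan_le]
      intro x hx
      simp only [Finset.coe_biUnion, Set.mem_iUnion, Finset.coe_image] at hx
      obtain ⟨i, -, y, hy, rfl⟩ := hx
      exact map_mem_powRange_succ ν _ (hS ▸ LieSubmodule.subset_lieSpan hy)
    · refine iSup_le fun h => ?_
      rw [← hS, map_lieSpan, LieSubmodule.lieSpan_le]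
      rintro _ ⟨y, hy, rfl⟩
      rw [SetLike.mem_coe, apply_eq_sum_repr ν e]
      refine sum_mem fun i _ => SMulMemClass.smul_mem _ (LieSubmodule.subset_lieSpan ?_)
      simp only [Finset.coe_biUnion, Set.mem_iUnion, Finset.coe_image]
      exact ⟨i, by simp, y, hy, rfl⟩

/-- Commuting nilpotent endomorphisms spanning a finite dimensional space generate a nilpotent
ideal. -/
lemma exists_powRange_eq_bot [Module.Finite E ↥t]
    (hcomm : ∀ h h' m, ν h (ν h' m) = ν h' (ν h m))
    (hnil : ∀ h, IsNilpotent (ν h : M →ₗ[E] M)) : ∃ n, powRange ν n = ⊥ := by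
  let s : Set (Module.End E M) := Set.range fun h : ↥t => (ν h : M →ₗ[E] M)
  have hs : ∀ a ∈ s, ∀ c ∈ s, a * c = c * a := by
    rintro _ ⟨h, rfl⟩ _ ⟨h', rfl⟩
    exact LinearMap.ext fun m => hcomm h h' m
  let _ : CommRing (Algebra.adjoin E s) :=
    { (inferInstance : Ring (Algebra.adjoin E s)) with
      mul_comm := (Algebra.isMulCommutative_adjoin E hs).is_comm.comm }
  let a : ↥t → Algebra.adjoin E s := fun h => ⟨(ν h : M →ₗ[E] M), Algebra.subset_adjoin ⟨h, rfl⟩⟩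
  let e := Module.finBasis E ↥t
  let I : Ideal (Algebra.adjoin E s) := Ideal.span (Set.range fun i => a (e i))
  have haI : ∀ h, a h ∈ I := by
    intro h
    have : a h = ∑ i, e.repr h i • a (e i) := by
      apply Subtype.ext
      ext m
      simpa [a, AddSubmonoidClass.coe_finsetSum] using apply_eq_sum_repr ν e h m
    rw [this]
    exact sum_mem fun i _ => Submodule.smul_of_tower_mem I _ (Ideal.subset_span ⟨i, rfl⟩)
  have hI : IsNilpotent I := by
    rw [Ideal.FG.isNilpotent_iff_le_nilradical
      (Submodule.fg_span (Set.finite_range _)), Ideal.span_le]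
    rintro _ ⟨i, rfl⟩
    obtain ⟨N, hN⟩ := hnil (e i)
    exact ⟨N, Subtype.ext (by simpa [a] using hN)⟩
  obtain ⟨n, hn⟩ := hI
  have hle : ∀ k, ∀ m ∈ powRange ν k, m ∈ I ^ k • (⊤ : Submodule (Algebra.adjoin E s) M) := by
    intro k
    induction k with
    | zero => simp
    | succ k ih =>
      intro m hm
      induction hm using LieSubmodule.iSup_induction' with
      | zero => exact zero_mem _
      | add y z _ _ hy hz => exact add_mem hy hz
      | mem h y hy =>
        obtain ⟨z, hz, rfl⟩ := (LieSubmodule.mem_map _).1 hy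
        rw [pow_succ', Submodule.mul_smul]
        exact Submodule.smul_mem_smul (haI h) (ih z hz)
  refine ⟨n, (LieSubmodule.eq_bot_iff _).2 fun m hm => ?_⟩
  have := hle n m hm
  rw [hn] at this
  simpa using this

end NilpotentPart

section Filtration

variable {E : Type} [Field E] {g : Type} [LieRing g] [LieAlgebra E g] {t b : LieSubalgebra E g}
variable {M : Type} [AddCommGroup M] [Module E M] [LieRingModule g M] [LieModule E g M]

lemma nilpotentPart_mem_gwsp {ν : ↥t →ₗ[E] (M →ₗ⁅E,g⁆ M)} (h : ↥t) {χ : Module.Dual E ↥t} {m : M}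
    (hm : m ∈ gwsp E g t M χ) : ν h m ∈ gwsp E g t M χ :=
  map_mem_gwsp _ hm

lemma powRange_le_iSup_inf_gwsp {Λ : AddSubgroup (Module.Dual E ↥t)}
    (htop : ⨆ χ ∈ Λ, gwsp E g t M χ = ⊤) (ν : ↥t →ₗ[E] (M →ₗ⁅E,g⁆ M)) (k : ℕ) :
    (powRange ν k).toSubmodule ≤ ⨆ χ ∈ Λ, (powRange ν k).toSubmodule ⊓ gwsp E g t M χ := by
  induction k with
  | zero => simp [powRange, htop]
  | succ k ih =>
    rw [powRange, LieSubmodule.iSup_toSubmodule]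
    refine iSup_le fun h => ?_
    rw [LieSubmodule.toSubmodule_map]
    refine (Submodule.map_mono ih).trans ?_
    simp only [Submodule.map_iSup]
    refine iSup₂_mono fun χ _ => ?_
    rintro _ ⟨m, hm, rfl⟩
    refine ⟨?_, map_mem_gwsp (ν h) hm.2⟩
    have := map_mem_powRange_succ ν h hm.1
    rw [powRange, ← LieSubmodule.mem_toSubmodule, LieSubmodule.iSup_toSubmodule] at this
    exact this

lemma exists_filtration_of_inCatOInfAlg [Module.Finite E ↥t] [IsLieAbelian ↥t]
    {Λ : AddSubgroup (Module.Dual E ↥t)} (hroot : ⨆ α : Module.Dual E ↥t, rootSp E g t α = ⊤)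
    (hM : InCatOInfAlg E g t b M Λ) :
    ∃ (n : ℕ) (c : ℕ → LieSubmodule E g M), Monotone c ∧ c 0 = ⊥ ∧ c n = ⊤ ∧
      ∀ k < n, InCatOAlg E g t b (filtQuot c k) Λ := by
  obtain ⟨⟨hfg, hsp, hb⟩, halg⟩ := hM
  have htop := isESplit_iff.1 hsp
  have htopΛ : ⨆ χ ∈ Λ, gwsp E g t M χ = ⊤ :=
    top_le_iff.1 (htop ▸ iSup_gwsp_le_of_isAlgWt halg)
  obtain ⟨ν, hν⟩ := exists_nilpotentPart hsp hroot
  have hcomm : ∀ h h' m, ν h (ν h' m) = ν h' (ν h m) := by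
    intro h h' m
    have : (ν h : M →ₗ[E] M) ∘ₗ (ν h' : M →ₗ[E] M) = (ν h' : M →ₗ[E] M) ∘ₗ (ν h : M →ₗ[E] M) := by
      refine linearMap_ext_of_gwsp htop fun χ m hm => ?_
      simp only [LinearMap.comp_apply, LieModuleHom.coe_toLinearMap]
      rw [hν h' χ m hm, hν h' χ _ (nilpotentPart_mem_gwsp h hm), map_sub, map_smul,
        LieModuleHom.map_lie]
    exact LinearMap.congr_fun this m
  have hlocnil : ∀ h m, ∃ i, ((ν h : M →ₗ[E] M) ^ i) m = 0 := by
    intro h m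
    have hm : m ∈ ⨆ χ, gwsp E g t M χ := htop ▸ Submodule.mem_top
    induction hm using Submodule.iSup_induction' with
    | zero => exact ⟨0, by simp⟩
    | add x y _ _ hx hy =>
      obtain ⟨i, hi⟩ := hx
      obtain ⟨j, hj⟩ := hy
      refine ⟨i + j, ?_⟩
      rw [map_add, pow_add, Module.End.mul_apply, Module.End.mul_apply, hj, map_zero, add_zero,
        ← Module.End.mul_apply, ← pow_add, add_comm, pow_add, Module.End.mul_apply, hi, map_zero]
    | mem χ m hm =>
      obtain ⟨i, hi⟩ := mem_gwsp.1 hm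
      refine ⟨i, ?_⟩
      rw [← mem_wsp.1 hi h]
      clear hi
      induction i generalizing m with
      | zero => simp
      | succ i ih =>
        rw [pow_succ, pow_succ, Module.End.mul_apply, Module.End.mul_apply,
          LieModuleHom.coe_toLinearMap, ih _ (nilpotentPart_mem_gwsp h hm), hν h χ m hm]
        simp
  have hnil : ∀ h, IsNilpotent (ν h : M →ₗ[E] M) := by
    intro h
    obtain ⟨S, hS⟩ := hfg
    choose i hi using hlocnil h
    refine ⟨S.sup i, LinearMap.ext fun m => ?_⟩
    have hm : m ∈ LieSubmodule.lieSpan E g (S : Set M) := hS ▸ LieSubmodule.mem_top _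
    have hlie : ∀ (j : ℕ) (x : g) (m : M),
        ((ν h : M →ₗ[E] M) ^ j) ⁅x, m⁆ = ⁅x, ((ν h : M →ₗ[E] M) ^ j) m⁆ := by
      intro j
      induction j with
      | zero => simp
      | succ j ih => intro x m; simp [pow_succ, ih]
    induction hm using LieSubmodule.lieSpan_induction with
    | zero => simp
    | add x y _ _ hx hy => simp [hx, hy]
    | smul a x _ hx => simp [hx]
    | lie x y _ hy => rw [hlie, hy]; simp
    | mem x hx =>
      rw [← Nat.sub_add_cancel (Finset.le_sup (f := i) hx), pow_add, Module.End.mul_apply, hi,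
        map_zero, LinearMap.zero_apply]
  obtain ⟨n, hn⟩ := exists_powRange_eq_bot ν hcomm hnil
  refine ⟨n, fun k => powRange ν (n - k), fun i j hij => powRange_antitone ν (by omega), by simpa,
    by simp [powRange], fun k hk => ?_⟩
  refine inCatOAlg_quotient _ _ ?_ hb (powRange_le_iSup_inf_gwsp htopΛ ν _) ?_
  · exact (isFG_coe_iff _).2 (exists_lieSpan_eq_powRange ν hfg _)
  · intro χ m hm hχ h
    rw [← hν h χ m hχ]
    change ν h m ∈ powRange ν (n - k)
    rw [show n - k = n - (k + 1) + 1 by omega]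
    exact map_mem_powRange_succ ν h hm

end Filtration

section Triangularizable

open Polynomial

variable {E : Type} [Field E] {V : Type} [AddCommGroup V] [Module E V]

lemma exists_sub_smul_eq_of_mem_maxGenEigenspace (f : Module.End E V) {μ ν : E} (hμν : ν ≠ μ)
    {y : V} (hy : y ∈ f.maxGenEigenspace ν) :
    ∃ x ∈ f.maxGenEigenspace ν, f x - μ • x = y := by
  obtain ⟨k, hk⟩ := (Module.End.mem_maxGenEigenspace f ν y).1 hy
  induction k generalizing y with
  | zero => exact ⟨0, zero_mem _, by simpa using hk.symm⟩
  | succ k ih =>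
    have hy' : f y - ν • y ∈ f.maxGenEigenspace ν :=
      sub_mem (Module.End.mapsTo_maxGenEigenspace_of_comm (Commute.refl f) ν hy)
        (Submodule.smul_mem _ _ hy)
    obtain ⟨x, hx, hxy⟩ := ih hy' (by simpa [pow_succ] using hk)
    refine ⟨(ν - μ)⁻¹ • (y - x), Submodule.smul_mem _ _ (sub_mem hy hx), ?_⟩
    have : f (y - x) - μ • (y - x) = (ν - μ) • y := by
      rw [map_sub, smul_sub, sub_smul, sub_sub_sub_comm, hxy]
      abel
    rw [map_smul, smul_comm μ, ← smul_sub, this, smul_smul, inv_mul_cancel₀ (sub_ne_zero.2 hμν),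
      one_smul]

lemma mem_iSup_maxGenEigenspace_of_sub_smul_mem (f : Module.End E V) (μ : E) {v : V}
    (hv : f v - μ • v ∈ ⨆ ν, f.maxGenEigenspace ν) : v ∈ ⨆ ν, f.maxGenEigenspace ν := by
  have key : ∀ y ∈ ⨆ ν, f.maxGenEigenspace ν, ∃ x ∈ ⨆ ν, f.maxGenEigenspace ν,
      y - (f x - μ • x) ∈ f.maxGenEigenspace μ := by
    intro y hy
    induction hy using Submodule.iSup_induction' with
    | zero => exact ⟨0, zero_mem _, by simp⟩
    | add y z _ _ hy hz =>
      obtain ⟨x, hx, hxy⟩ := hy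
      obtain ⟨w, hw, hwz⟩ := hz
      refine ⟨x + w, add_mem hx hw, ?_⟩
      convert add_mem hxy hwz using 1
      rw [map_add, smul_add]
      abel
    | mem ν y hy =>
      by_cases hμν : ν = μ
      · exact ⟨0, zero_mem _, by simpa [hμν] using hy⟩
      · obtain ⟨x, hx, rfl⟩ := exists_sub_smul_eq_of_mem_maxGenEigenspace f hμν hy
        exact ⟨x, Submodule.mem_iSup_of_mem ν hx, by simp⟩
  obtain ⟨x, hx, h⟩ := key _ hv
  have hvx : v - x ∈ f.maxGenEigenspace μ := by
    obtain ⟨k, hk⟩ := (Module.End.mem_maxGenEigenspace f μ _).1 h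
    refine (Module.End.mem_maxGenEigenspace f μ _).2 ⟨k + 1, ?_⟩
    rw [pow_succ, Module.End.mul_apply, ← hk]
    congr 1
    simp [smul_sub]
    abel
  simpa using add_mem (Submodule.mem_iSup_of_mem μ hvx) hx

lemma mem_iSup_maxGenEigenspace_of_splits (f : Module.End E V) {p : E[X]} (hp : p ≠ 0)
    (hs : p.Splits) {v : V} (hv : aeval f p v = 0) : v ∈ ⨆ ν, f.maxGenEigenspace ν := by
  obtain ⟨s, hs⟩ := splits_iff_exists_multiset.1 hs
  have hv' : aeval f (s.map fun a => X - C a).prod v = 0 := by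
    rw [hs] at hv
    simpa [Module.algebraMap_end_apply, hp] using hv
  clear hv hs
  induction s using Multiset.induction_on generalizing v with
  | empty =>
    have h0 : v = 0 := by simpa using hv'
    exact h0 ▸ zero_mem _
  | cons a s ih =>
    refine mem_iSup_maxGenEigenspace_of_sub_smul_mem f a (ih ?_)
    rw [Multiset.map_cons, Multiset.prod_cons, mul_comm, map_mul, Module.End.mul_apply] at hv'
    simpa [Module.algebraMap_end_apply] using hv'

end Triangularizable

section Extension

open Polynomial

variable {E : Type} [Field E] {g : Type} [LieRing g] [LieAlgebra E g] {t b : LieSubalgebra E g}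
variable {M : Type} [AddCommGroup M] [Module E M] [LieRingModule g M] [LieModule E g M]
variable {P Q : LieSubmodule E g M}

lemma map_aeval_toEnd {P : Type} [AddCommGroup P] [Module E P] [LieRingModule g P]
    [LieModule E g P] (f : M →ₗ⁅E,g⁆ P) (x : g) (p : E[X]) (m : M) :
    f (aeval (LieModule.toEnd E g M x) p m) = aeval (LieModule.toEnd E g P x) p (f m) := by
  induction p using Polynomial.induction_on' with
  | add p q hp hq => simp [hp, hq]
  | monomial n a =>
    have := map_pow_toEnd_sub f x 0 n m
    simp only [zero_smul, sub_zero] at this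
    simp [aeval_monomial, Module.algebraMap_end_apply, this]

lemma exists_lieSpan_eq_of_quotient (hPQ : P ≤ Q)
    (hP : ∃ S : Finset M, LieSubmodule.lieSpan E g (S : Set M) = P)
    (hQ : IsFG E g (↥Q ⧸ LieSubmodule.comap Q.incl P)) :
    ∃ S : Finset M, LieSubmodule.lieSpan E g (S : Set M) = Q := by
  classical
  obtain ⟨S, hS⟩ := hP
  obtain ⟨T, hT⟩ := hQ
  set π := LieSubmodule.Quotient.mk' (LieSubmodule.comap Q.incl P)
  have hπ : Function.Surjective π := LieSubmodule.Quotient.surjective_mk' _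
  choose σ hσ using hπ
  have hspan : (LieSubmodule.lieSpan E g (σ '' T)).map π = ⊤ := by
    rw [map_lieSpan, ← hT, Set.image_image]
    simp [hσ]
  refine ⟨S ∪ T.image fun x => Q.incl (σ x), le_antisymm ?_ ?_⟩
  · rw [LieSubmodule.lieSpan_le]
    intro x hx
    rcases Finset.mem_union.1 (Finset.mem_coe.1 hx) with hx | hx
    · exact hPQ (hS ▸ LieSubmodule.subset_lieSpan hx)
    · obtain ⟨y, -, rfl⟩ := Finset.mem_image.1 hx
      exact (σ y).2
  · intro q hq
    have h1 : π ⟨q, hq⟩ ∈ (LieSubmodule.lieSpan E g (σ '' T)).map π :=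
      hspan ▸ LieSubmodule.mem_top _
    obtain ⟨y, hy, hyq⟩ := (LieSubmodule.mem_map _).1 h1
    have h2 : (⟨q, hq⟩ - y : ↥Q) ∈ LieSubmodule.comap Q.incl P := by
      rw [← LieSubmodule.Quotient.mk_eq_zero, map_sub]
      exact sub_eq_zero.2 hyq.symm
    have h3 : q - (y : M) ∈ P := h2
    have h4 : (y : M) ∈ LieSubmodule.lieSpan E g (Q.incl '' (σ '' T)) := by
      rw [← map_lieSpan]
      exact LieSubmodule.mem_map_of_mem hy
    have h5 : q = (q - (y : M)) + y := by abel
    rw [h5]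
    refine add_mem ?_ ?_
    · rw [← hS] at h3
      exact LieSubmodule.lieSpan_mono (by simp) h3
    · refine LieSubmodule.lieSpan_mono ?_ h4
      rw [Set.image_image]
      simp

lemma exists_splits_of_quotient [IsLieAbelian ↥t] (h : ↥t)
    (hP : ∀ m ∈ P, ∃ p : E[X], p ≠ 0 ∧ p.Splits ∧ aeval (LieModule.toEnd E g M (h : g)) p m = 0)
    (hQ : IsDiagonalizable E g t (↥Q ⧸ LieSubmodule.comap Q.incl P)) :
    ∀ m ∈ Q, ∃ p : E[X], p ≠ 0 ∧ p.Splits ∧ aeval (LieModule.toEnd E g M (h : g)) p m = 0 := by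
  intro m hm
  set π := LieSubmodule.Quotient.mk' (LieSubmodule.comap Q.incl P)
  have key : ∀ q : ↥Q ⧸ LieSubmodule.comap Q.incl P, ∃ p : E[X], p ≠ 0 ∧ p.Splits ∧
      aeval (LieModule.toEnd E g (↥Q ⧸ LieSubmodule.comap Q.incl P) (h : g)) p q = 0 := by
    intro q
    have hq : q ∈ ⨆ χ, wsp E g t (↥Q ⧸ LieSubmodule.comap Q.incl P) 1 χ :=
      isDiagonalizable_iff.1 hQ ▸ Submodule.mem_top
    induction hq using Submodule.iSup_induction' with
    | zero => exact ⟨1, one_ne_zero, Splits.one, map_zero _⟩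
    | add x y _ _ hx hy =>
      obtain ⟨p, hp0, hps, hp⟩ := hx
      obtain ⟨r, hr0, hrs, hr⟩ := hy
      refine ⟨p * r, mul_ne_zero hp0 hr0, hps.mul hrs, ?_⟩
      rw [map_add, map_mul, Module.End.mul_apply, Module.End.mul_apply, hr, map_zero, add_zero,
        ← Module.End.mul_apply, ← map_mul, mul_comm, map_mul, Module.End.mul_apply, hp, map_zero]
    | mem χ x hx =>
      refine ⟨X - C (χ h), X_sub_C_ne_zero _, Splits.X_sub_C _, ?_⟩
      simpa [Module.algebraMap_end_apply] using mem_wsp_one.1 hx h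
  obtain ⟨p, hp0, hps, hp⟩ := key (π ⟨m, hm⟩)
  rw [← map_aeval_toEnd π, LieSubmodule.Quotient.mk_eq_zero] at hp
  have hp' : aeval (LieModule.toEnd E g M (h : g)) p m ∈ P := by
    have h1 := LieSubmodule.mem_comap.1 hp
    rwa [map_aeval_toEnd Q.incl] at h1
  obtain ⟨r, hr0, hrs, hr⟩ := hP _ hp'
  refine ⟨r * p, mul_ne_zero hr0 hp0, hrs.mul hps, ?_⟩
  rw [map_mul, Module.End.mul_apply, hr]

lemma eq_zero_of_mem_gwsp_of_quotient {Λ : AddSubgroup (Module.Dual E ↥t)}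
    {χ : Module.Dual E ↥t} (hχ : χ ∉ Λ) (hP : ∀ m ∈ P, m ∈ gwsp E g t M χ → m = 0)
    (hQ : IsAlgWt E g t (↥Q ⧸ LieSubmodule.comap Q.incl P) Λ) :
    ∀ m ∈ Q, m ∈ gwsp E g t M χ → m = 0 := by
  intro m hm hmχ
  have h0 : gwsp E g t (↥Q ⧸ LieSubmodule.comap Q.incl P) χ = ⊥ := by
    by_contra h
    exact hχ (hQ χ h)
  have h1 := map_mem_gwsp (LieSubmodule.Quotient.mk' (LieSubmodule.comap Q.incl P))
    (mem_gwsp_of_injective Q.incl Subtype.val_injective (m := ⟨m, hm⟩) hmχ)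
  rw [h0, Submodule.mem_bot, LieSubmodule.Quotient.mk_eq_zero] at h1
  exact hP m h1 hmχ

lemma exists_finite_stable_of_quotient [Module.Finite E g]
    (hP : ∀ m ∈ P, ∃ W : Submodule E M, FiniteDimensional E ↥W ∧ m ∈ W ∧
      ∀ x : ↥b, ∀ w ∈ W, ⁅(x : g), w⁆ ∈ W)
    (hQ : IsLocBFinite E g b (↥Q ⧸ LieSubmodule.comap Q.incl P)) :
    ∀ m ∈ Q, ∃ W : Submodule E M, FiniteDimensional E ↥W ∧ m ∈ W ∧
      ∀ x : ↥b, ∀ w ∈ W, ⁅(x : g), w⁆ ∈ W := by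
  intro m hm
  set π := LieSubmodule.Quotient.mk' (LieSubmodule.comap Q.incl P)
  obtain ⟨σ, hσ⟩ := (π : ↥Q →ₗ[E] (↥Q ⧸ LieSubmodule.comap Q.incl P)).exists_rightInverse_of_surjective
    (LinearMap.range_eq_top.2 (LieSubmodule.Quotient.surjective_mk' _))
  have hσ' : ∀ q, π (σ q) = q := fun q => LinearMap.congr_fun hσ q
  have hdiff : ∀ y : ↥Q, (y : M) - (σ (π y) : M) ∈ P := by
    intro y
    have : y - σ (π y) ∈ LieSubmodule.comap Q.incl P := by
      rw [← LieSubmodule.Quotient.mk_eq_zero, map_sub, sub_eq_zero]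
      exact (hσ' _).symm
    exact this
  obtain ⟨W₁, hW₁, hmW₁, hst₁⟩ := hQ (π ⟨m, hm⟩)
  let W₀ : Submodule E M := W₁.map (Q.toSubmodule.subtype ∘ₗ σ)
  have hW₀ : FiniteDimensional E ↥W₀ := inferInstance
  let β : g →ₗ[E] M →ₗ[E] M :=
    LinearMap.mk₂ E (fun (x : g) (m : M) => ⁅x, m⁆) add_lie smul_lie lie_add fun a x m => lie_smul a x m
  let U : Submodule E M := Submodule.map₂ β b.toSubmodule W₀ ⊔ Submodule.span E {m}
  have hUfg : U.FG :=
    (Submodule.FG.map₂ _ (IsNoetherian.noetherian _) (Submodule.fg_iff_finiteDimensional _ |>.2 hW₀)).sup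
      (Submodule.fg_span_singleton m)
  have hmem : ∀ y : ↥Q, π y ∈ W₁ → (y : M) ∈ W₀ ⊔ P.toSubmodule := by
    intro y hy
    have : (y : M) = (σ (π y) : M) + ((y : M) - (σ (π y) : M)) := by abel
    rw [this]
    exact Submodule.add_mem_sup ⟨π y, hy, rfl⟩ (hdiff y)
  have hUle : U ≤ W₀ ⊔ P.toSubmodule := by
    refine sup_le (Submodule.map₂_le.2 ?_) ?_
    · rintro x hx _ ⟨w, hw, rfl⟩
      refine hmem ⁅x, σ w⁆ ?_
      rw [LieModuleHom.map_lie, hσ']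
      exact hst₁ ⟨x, hx⟩ w hw
    · rw [Submodule.span_singleton_le_iff_mem]
      exact hmem ⟨m, hm⟩ hmW₁
  have key : ∀ U : Submodule E M, U.FG → U ≤ W₀ ⊔ P.toSubmodule →
      ∃ F : Submodule E M, FiniteDimensional E ↥F ∧ U ≤ W₀ ⊔ F ∧
        ∀ x : ↥b, ∀ w ∈ F, ⁅(x : g), w⁆ ∈ F := by
    intro U hU
    induction U, hU using Submodule.fg_induction with
    | singleton x =>
      intro hx
      rw [Submodule.span_singleton_le_iff_mem, Submodule.mem_sup] at hx
      obtain ⟨w, hw, p, hp, rfl⟩ := hx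
      obtain ⟨F, hF, hpF, hst⟩ := hP p hp
      exact ⟨F, hF, (Submodule.span_singleton_le_iff_mem _ _).2 (Submodule.add_mem_sup hw hpF), hst⟩
    | sup U₁ U₂ _ _ ih₁ ih₂ =>
      intro hle
      obtain ⟨F₁, hF₁, hU₁, hst₁⟩ := ih₁ (le_sup_left.trans hle)
      obtain ⟨F₂, hF₂, hU₂, hst₂⟩ := ih₂ (le_sup_right.trans hle)
      refine ⟨F₁ ⊔ F₂, inferInstance, sup_le (hU₁.trans (sup_le_sup_left le_sup_left _))
        (hU₂.trans (sup_le_sup_left le_sup_right _)), fun x w hw => ?_⟩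
      obtain ⟨w₁, hw₁, w₂, hw₂, rfl⟩ := Submodule.mem_sup.1 hw
      rw [lie_add]
      exact Submodule.add_mem_sup (hst₁ x _ hw₁) (hst₂ x _ hw₂)
  obtain ⟨F, hF, hUF, hstF⟩ := key U hUfg hUle
  refine ⟨W₀ ⊔ F, inferInstance,
    hUF (Submodule.mem_sup_right (Submodule.mem_span_singleton_self m)), ?_⟩
  intro x w hw
  obtain ⟨w₁, hw₁, w₂, hw₂, rfl⟩ := Submodule.mem_sup.1 hw
  rw [lie_add]
  exact add_mem (hUF (Submodule.mem_sup_left (Submodule.apply_mem_map₂ β x.2 hw₁)))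
    (Submodule.mem_sup_right (hstF x _ hw₂))

/-- Local finiteness for `b ⊇ t` together with split annihilating polynomials for the elements
of `t` yields the generalized weight space decomposition. -/
lemma isESplit_of_isLocBFinite [IsLieAbelian ↥t] (htb : t ≤ b) (hb : IsLocBFinite E g b M)
    (hs : ∀ (h : ↥t) (m : M), ∃ p : E[X], p ≠ 0 ∧ p.Splits ∧
      aeval (LieModule.toEnd E g M (h : g)) p m = 0) : IsESplit E g t M := by
  rw [isESplit_iff, eq_top_iff]
  rintro m -
  obtain ⟨W, hW, hmW, hst⟩ := hb m
  let N : LieSubmodule E ↥t M := { W with lie_mem := fun {x m} hm => hst ⟨x, htb x.2⟩ m hm }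
  have : FiniteDimensional E ↥N := hW
  have htri : LieModule.IsTriangularizable E ↥t ↥N := by
    refine ⟨fun h => eq_top_iff.2 fun n _ => ?_⟩
    obtain ⟨p, hp0, hps, hp⟩ := hs h n
    refine mem_iSup_maxGenEigenspace_of_splits _ hp0 hps (Subtype.ext ?_)
    exact (map_aeval_toEnd N.incl h p n).trans hp
  have hmN : (⟨m, hmW⟩ : ↥N) ∈ ⨆ χ : LieModule.Weight E ↥t ↥N, LieModule.genWeightSpace ↥N χ :=
    LieModule.iSup_genWeightSpace_eq_top' E ↥t ↥N ▸ LieSubmodule.mem_top _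
  have key : ∀ n : ↥N, n ∈ ⨆ χ : LieModule.Weight E ↥t ↥N, LieModule.genWeightSpace ↥N χ →
      (n : M) ∈ ⨆ χ, gwsp E g t M χ := by
    intro n hn
    induction hn using LieSubmodule.iSup_induction' with
    | zero => exact zero_mem _
    | add x y _ _ hx hy => exact add_mem hx hy
    | mem χ n hn =>
      refine Submodule.mem_iSup_of_mem (LieModule.Weight.toLinear E ↥t ↥N χ)
        (mem_gwsp.2 ⟨Module.finrank E ↥N, mem_wsp.2 fun h => ?_⟩)
      have hn' : n ∈ (LieModule.toEnd E ↥t ↥N h).maxGenEigenspace (χ h) :=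
        (Module.End.mem_maxGenEigenspace _ _ _).2 ((LieModule.mem_genWeightSpace _ _ _).1 hn h)
      rw [Module.End.maxGenEigenspace_eq_genEigenspace_finrank, Module.End.mem_genEigenspace_nat,
        LinearMap.mem_ker] at hn'
      refine (map_pow_toEnd_sub N.incl h (χ h) (Module.finrank E ↥N) n).symm.trans ?_
      rw [hn', map_zero]
  exact key _ hmN

lemma inCatOInfAlg_of_filtration [Module.Finite E g] [IsLieAbelian ↥t] (htb : t ≤ b)
    {Λ : AddSubgroup (Module.Dual E ↥t)} {n : ℕ} {c : ℕ → LieSubmodule E g M} (hc : Monotone c)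
    (h0 : c 0 = ⊥) (hn : c n = ⊤) (hq : ∀ k < n, InCatOAlg E g t b (filtQuot c k) Λ) :
    InCatOInfAlg E g t b M Λ := by
  have induct : ∀ p : LieSubmodule E g M → Prop, p ⊥ →
      (∀ k < n, p (c k) → p (c (k + 1))) → p ⊤ := by
    intro p hbot hsucc
    have : ∀ k ≤ n, p (c k) := by
      intro k
      induction k with
      | zero => exact fun _ => h0 ▸ hbot
      | succ k ih => exact fun hk => hsucc k hk (ih (by omega))
    exact hn ▸ this n le_rfl
  have hfg : IsFG E g M := induct
    (fun N => ∃ S : Finset M, LieSubmodule.lieSpan E g (S : Set M) = N)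
    ⟨∅, by simp⟩ fun k hk h => exists_lieSpan_eq_of_quotient (hc k.le_succ) h (hq k hk).1.1
  have hb : IsLocBFinite E g b M := fun m => induct
    (fun N => ∀ m ∈ N, ∃ W : Submodule E M, FiniteDimensional E ↥W ∧ m ∈ W ∧
      ∀ x : ↥b, ∀ w ∈ W, ⁅(x : g), w⁆ ∈ W)
    (fun m hm => ⟨⊥, inferInstance, by simpa using hm, by simp⟩)
    (fun k hk h => exists_finite_stable_of_quotient h (hq k hk).1.2.2) m (LieSubmodule.mem_top _)
  have hs : ∀ (h : ↥t) (m : M), ∃ p : E[X], p ≠ 0 ∧ p.Splits ∧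
      aeval (LieModule.toEnd E g M (h : g)) p m = 0 := fun h m => induct
    (fun N => ∀ m ∈ N, ∃ p : E[X], p ≠ 0 ∧ p.Splits ∧
      aeval (LieModule.toEnd E g M (h : g)) p m = 0)
    (fun m hm => ⟨1, one_ne_zero, Splits.one, by simpa using hm⟩)
    (fun k hk hP => exists_splits_of_quotient h hP (hq k hk).1.2.1) m (LieSubmodule.mem_top _)
  refine ⟨⟨hfg, isESplit_of_isLocBFinite htb hb hs, hb⟩, fun χ hχ => ?_⟩
  by_contra hΛ
  refine hχ ((Submodule.eq_bot_iff _).2 fun m hm => induct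
    (fun N => ∀ m ∈ N, m ∈ gwsp E g t M χ → m = 0) (fun m hm _ => by simpa using hm)
    (fun k hk hP => eq_zero_of_mem_gwsp_of_quotient hΛ hP (hq k hk).2) m
    (LieSubmodule.mem_top _) hm)

end Extension

/-- a `U(g_E)`-module `M` belongs to `O^∞_alg` if and only if there is a
finite filtration `0 = M_0 ⊆ M_1 ⊆ … ⊆ M_n = M` by `U(g_E)`-submodules all of whose
successive quotients `M_k/M_{k-1}` lie in category `O_alg`. -/
theorem inCatOInfAlg_iff_filtration_catOAlg
    (E : Type) [Field E] [CharZero E]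
    (g : Type) [LieRing g] [LieAlgebra E g] [Module.Finite E g]
    (t b : LieSubalgebra E g)
    (Λ : AddSubgroup (Module.Dual E ↥t))
    (htb : t ≤ b) (habel : IsLieAbelian ↥t)
    (Φ Φp : Finset (Module.Dual E ↥t))
    (hΦ0 : (0 : Module.Dual E ↥t) ∉ Φ)
    (hcartan : t.toSubmodule ⊔ (⨆ α ∈ Φ, rootSp E g t α) = ⊤)
    (hΦp : ∀ α, α ∈ Φp ↔ α ∈ Φ ∧ rootSp E g t α ≤ b.toSubmodule)
    (hborel : t.toSubmodule ⊔ (⨆ α ∈ Φp, rootSp E g t α) = b.toSubmodule)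
    (hsplit : ∀ α ∈ Φ, α ∈ Φp ∨ -α ∈ Φp)
    (M : Type) [AddCommGroup M] [Module E M] [LieRingModule g M] [LieModule E g M] :
    InCatOInfAlg E g t b M Λ ↔
      ∃ (n : ℕ) (c : ℕ → LieSubmodule E g M), Monotone c ∧ c 0 = ⊥ ∧ c n = ⊤ ∧
        ∀ k < n, InCatOAlg E g t b (filtQuot c k) Λ := by
  have := habel
  constructor
  · refine exists_filtration_of_inCatOInfAlg (top_le_iff.1 (hcartan ▸ sup_le ?_ ?_))
    · exact toSubmodule_le_rootSp_zero.trans (le_iSup (fun α => rootSp E g t α) 0)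
    · exact iSup₂_le fun α _ => le_iSup (fun α => rootSp E g t α) α
  · rintro ⟨n, c, hc, h0, hn, hq⟩
    exact inCatOInfAlg_of_filtration htb hc h0 hn hq

end PaperO
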